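/- Let N be a positive integer and let Ω ⊂ ℝ³ be a bounded measurable set with |Ω| = N. Then the indirect energy of the uniform density satisfies E_Ind^{(N)}(1_Ω) ≥ inf_{x_1,…,x_N ∈ ℝ³} E_Jel(Ω; x_1,…,x_N). -/

import Mathlib

open MeasureTheory Real Set Filter Classical
open scoped ENNReal Pointwise BigOperators Topology

noncomputable section

/-- Three-dimensional Euclidean space. -/
abbrev E3 := EuclideanSpace ℝ (Fin 3)

/-- Coulomb kernel `|x-y|⁻¹`, interpreted as `+∞` when the points coincide. -/
def coulK (x y : E3) : EReal := if x = y then ⊤ else ((‖x - y‖⁻¹ : ℝ) : EReal)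

/-- Total pair interaction `∑_{j<k} |x_j - x_k|⁻¹`, valued in extended reals. -/
def pairEnergy {N : ℕ} (X : Fin N → E3) : EReal :=
  ∑ j : Fin N, ∑ k ∈ Finset.Ioi j, coulK (X j) (X k)

/-- Hartree energy `D(f,g) = ½∬ f(x) g(y) |x-y|⁻¹ dx dy`. -/
def hartree (f g : E3 → ℝ) : ℝ :=
  (1/2) * ∫ x, ∫ y, f x * g y * ‖x - y‖⁻¹

/-- Jellium energy of points `X` in the background `Ω`, valued in extended reals. -/
def jelliumE (Ω : Set E3) {N : ℕ} (X : Fin N → E3) : EReal :=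
  pairEnergy X - (((∑ j, ∫ y in Ω, ‖X j - y‖⁻¹) : ℝ) : EReal)
    + ((hartree (Ω.indicator 1) (Ω.indicator 1) : ℝ) : EReal)

/-- `P` has one-particle density `ρ`. -/
def HasDensity {N : ℕ} (P : Measure (Fin N → E3)) (ρ : E3 → ℝ) : Prop :=
  ∀ φ : E3 → ℝ, Measurable φ → (∃ C, ∀ x, |φ x| ≤ C) →
    ∫ z, (∑ j, φ (z j)) ∂P = ∫ x, φ x * ρ x

/-- The positive part of an extended real, as an element of `ℝ≥0∞`. -/
def ERealPos (a : EReal) : ℝ≥0∞ := if a = ⊤ then ⊤ else ENNReal.ofReal a.toReal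

/-- Integral of an extended-real-valued function: difference of the lower
integrals of the positive and negative parts. -/
def eintegral {α : Type*} [MeasurableSpace α] (P : Measure α) (f : α → EReal) : EReal :=
  ((∫⁻ z, ERealPos (f z) ∂P : ℝ≥0∞) : EReal) - ((∫⁻ z, ERealPos (-(f z)) ∂P : ℝ≥0∞) : EReal)

/-- Indirect (Levy-Lieb) energy of a density `ρ` for `N` particles. -/
def indirectEnergy (N : ℕ) (ρ : E3 → ℝ) : EReal :=
  sInf {e : EReal | ∃ P : Measure (Fin N → E3), IsProbabilityMeasure P ∧ HasDensity P ρ ∧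
    e = eintegral P pairEnergy - ((hartree ρ ρ : ℝ) : EReal)}

/-- Convolution `f ∗ g`. -/
def conv (f g : E3 → ℝ) (x : E3) : ℝ := ∫ y, f y * g (x - y)

end

noncomputable section

/-- The Coulomb kernel truncated to the unit ball. -/
def shortRangeCoulomb : E3 → ℝ := (Metric.ball 0 1).indicator fun z ↦ ‖z‖⁻¹

theorem integrable_shortRangeCoulomb : Integrable shortRangeCoulomb := by
  refine IntegrableOn.integrable_indicator ?_ measurableSet_ball
  refine integrableOn_ball_of_norm_le_rpow (C := 1) (α := 1) (by simp) (by simp) ?_ ?_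
  · refine ae_of_all _ fun z ↦ ?_
    simp [Real.rpow_neg_one]
  · exact (measurable_norm.inv).aestronglyMeasurable

theorem inv_norm_le_shortRangeCoulomb_add_one (z : E3) : ‖z‖⁻¹ ≤ shortRangeCoulomb z + 1 := by
  unfold shortRangeCoulomb
  by_cases hz : z ∈ Metric.ball (0 : E3) 1
  · simp [Set.indicator_of_mem hz]
  · rw [Set.indicator_of_notMem hz, zero_add]
    exact inv_le_one_of_one_le₀ (by simpa using hz)

theorem shortRangeCoulomb_nonneg (z : E3) : 0 ≤ shortRangeCoulomb z :=
  Set.indicator_nonneg (fun _ _ ↦ by positivity) z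

/-- The Coulomb potential generated by the uniform background `Ω`. -/
def backgroundPotential (Ω : Set E3) (x : E3) : ℝ := ∫ y in Ω, ‖x - y‖⁻¹

theorem measurable_backgroundPotential (Ω : Set E3) : Measurable (backgroundPotential Ω) := by
  have h : Measurable fun p : E3 × E3 ↦ ‖p.1 - p.2‖⁻¹ := by fun_prop
  exact (h.stronglyMeasurable.integral_prod_right (ν := volume.restrict Ω)).measurable

theorem abs_backgroundPotential_le {Ω : Set E3} (hΩ : volume Ω ≠ ∞) (x : E3) :
    |backgroundPotential Ω x| ≤ (∫ z, shortRangeCoulomb z) + volume.real Ω := by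
  have hint : Integrable fun y ↦ shortRangeCoulomb (x - y) :=
    integrable_shortRangeCoulomb.comp_sub_left x
  have hone : IntegrableOn (fun _ : E3 ↦ (1 : ℝ)) Ω := integrableOn_const hΩ
  unfold backgroundPotential
  rw [abs_of_nonneg (integral_nonneg fun _ ↦ by positivity)]
  calc ∫ y in Ω, ‖x - y‖⁻¹ ≤ ∫ y in Ω, (shortRangeCoulomb (x - y) + 1) :=
        integral_mono_of_nonneg (ae_of_all _ fun _ ↦ by positivity)
          (hint.integrableOn.add hone)
          (ae_of_all _ fun y ↦ inv_norm_le_shortRangeCoulomb_add_one (x - y))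
    _ = (∫ y in Ω, shortRangeCoulomb (x - y)) + volume.real Ω := by
        rw [integral_add hint.integrableOn hone]; simp
    _ ≤ (∫ y, shortRangeCoulomb (x - y)) + volume.real Ω := by
        exact add_le_add_left (setIntegral_le_integral hint
          (ae_of_all _ fun y ↦ shortRangeCoulomb_nonneg (x - y))) _
    _ = (∫ z, shortRangeCoulomb z) + volume.real Ω := by
        rw [integral_sub_left_eq_self shortRangeCoulomb volume x]

theorem integral_backgroundPotential_mul_indicator {Ω : Set E3} (hΩ : MeasurableSet Ω) :
    ∫ x, backgroundPotential Ω x * Ω.indicator (1 : E3 → ℝ) x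
      = 2 * hartree (Ω.indicator 1) (Ω.indicator 1) := by
  unfold hartree
  rw [← mul_assoc]
  norm_num only [one_mul]
  refine integral_congr_ae (ae_of_all _ fun x ↦ ?_)
  simp only [mul_assoc, backgroundPotential]
  rw [integral_const_mul, mul_comm, ← integral_indicator hΩ]
  congr 2
  ext y
  by_cases hy : y ∈ Ω <;> simp [hy]

theorem ERealPos_eq_toENNReal (a : EReal) : ERealPos a = a.toENNReal := by
  unfold ERealPos
  split_ifs with h
  · simp [h]
  · exact (EReal.toENNReal_of_ne_top h).symm

theorem pairEnergy_nonneg {N : ℕ} (X : Fin N → E3) : 0 ≤ pairEnergy X := by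
  refine Finset.sum_nonneg fun j _ ↦ Finset.sum_nonneg fun k _ ↦ ?_
  unfold coulK
  split_ifs
  · exact le_top
  · exact_mod_cast inv_nonneg.2 (norm_nonneg _)

theorem eintegral_pairEnergy {N : ℕ} (P : Measure (Fin N → E3)) :
    eintegral P pairEnergy = ((∫⁻ X, (pairEnergy X).toENNReal ∂P : ℝ≥0∞) : EReal) := by
  have h (X : Fin N → E3) : (-pairEnergy X).toENNReal = 0 :=
    EReal.toENNReal_of_nonpos (by simpa using pairEnergy_nonneg X)
  simp [eintegral, ERealPos_eq_toENNReal, h]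

theorem ofReal_integral_le_lintegral_ofReal {α : Type*} [MeasurableSpace α] {μ : Measure α}
    {g : α → ℝ} (hg : Integrable g μ) :
    ENNReal.ofReal (∫ a, g a ∂μ) ≤ ∫⁻ a, ENNReal.ofReal (g a) ∂μ := by
  rw [integral_eq_lintegral_pos_part_sub_lintegral_neg_part hg]
  exact (ENNReal.ofReal_le_ofReal (sub_le_self _ ENNReal.toReal_nonneg)).trans
    ENNReal.ofReal_toReal_le

theorem integrable_sum_backgroundPotential {N : ℕ} (P : Measure (Fin N → E3))
    [IsFiniteMeasure P] {Ω : Set E3} (hΩ : volume Ω ≠ ∞) :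
    Integrable (fun X : Fin N → E3 ↦ ∑ j, backgroundPotential Ω (X j)) P := by
  refine integrable_finsetSum _ fun j _ ↦ ?_
  exact Integrable.of_bound
    ((measurable_backgroundPotential Ω).comp (measurable_pi_apply j)).aestronglyMeasurable
    _ (ae_of_all _ fun X ↦ abs_backgroundPotential_le hΩ (X j))

/-- For `|Ω| = N`, the indirect energy of the uniform density `1_Ω`
is at least the Jellium ground state energy of the background `Ω`. -/
theorem statement1 (N : ℕ) (hN : 0 < N) (Ω : Set E3) (hΩmeas : MeasurableSet Ω)
    (hΩbdd : Bornology.IsBounded Ω) (hΩvol : volume Ω = N) :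
    indirectEnergy N (Ω.indicator 1) ≥ ⨅ X : Fin N → E3, jelliumE Ω X := by
  have hΩ : volume Ω ≠ ∞ := by simp [hΩvol]
  refine le_sInf ?_
  rintro e ⟨P, hP, hdens, rfl⟩
  refine EReal.ge_of_forall_gt_iff_ge.1 fun c hc ↦ ?_
  rw [eintegral_pairEnergy]
  set H := hartree (Ω.indicator 1) (Ω.indicator 1) with hH
  have hpair (X : Fin N → E3) :
      ENNReal.ofReal (c - H + ∑ j, backgroundPotential Ω (X j)) ≤ (pairEnergy X).toENNReal := by
    rw [← EReal.real_coe_toENNReal]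
    apply EReal.toENNReal_le_toENNReal
    have hX : (c : EReal) ≤ jelliumE Ω X := hc.le.trans (iInf_le _ X)
    have hpos := pairEnergy_nonneg X
    unfold jelliumE at hX
    rw [← hH] at hX
    change (c : EReal) ≤ pairEnergy X - ((∑ j, backgroundPotential Ω (X j) : ℝ) : EReal) + H at hX
    generalize (∑ j, backgroundPotential Ω (X j)) = s at hX ⊢
    generalize pairEnergy X = p at hX hpos ⊢
    induction p with
    | bot => simp at hpos
    | top => exact le_top
    | coe p => norm_cast at hX ⊢; linarith
  have hsum := integrable_sum_backgroundPotential P hΩ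
  have hmean : ∫ X, (c - H + ∑ j, backgroundPotential Ω (X j)) ∂P = c + H := by
    rw [integral_add (integrable_const _) hsum,
      hdens _ (measurable_backgroundPotential Ω) ⟨_, abs_backgroundPotential_le hΩ⟩,
      integral_backgroundPotential_mul_indicator hΩmeas, ← hH]
    simp
    ring
  have hle : ENNReal.ofReal (c + H) ≤ ∫⁻ X, (pairEnergy X).toENNReal ∂P := by
    rw [← hmean]
    exact (ofReal_integral_le_lintegral_ofReal ((integrable_const _).add hsum)).trans
      (lintegral_mono hpair)
  rw [EReal.le_sub_iff_add_le (by simp) (by simp), ← EReal.coe_add]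
  refine le_trans ?_ (EReal.coe_ennreal_le_coe_ennreal_iff.2 hle)
  rw [EReal.coe_ennreal_ofReal]
  exact_mod_cast le_max_left _ _

end
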